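/- Let X be a finite-dimensional polyhedral real normed space, E a finite-dimensional real normed space, and f : S_X → S_E a bijective isometry between their unit spheres. Then the positively homogeneous extension F of f is a linear operator and, therefore, a surjective linear isometry from X onto E extending f. -/

import Mathlib

open Filter Topology Metric Set MeasureTheory

noncomputable section

/-- The normalized direction `v / ‖v‖` of a vector (equal to `0` when `v = 0`). -/
def unitDir {X : Type*} [NormedAddCommGroup X] [NormedSpace ℝ X] (v : X) : X := ‖v‖⁻¹ • v

/-- The set `ℷ(x)` of support functionals at a point `x` of the unit sphere:
functionals of norm one attaining the value `1` at `x`. -/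
def suppFn (X : Type*) [NormedAddCommGroup X] [NormedSpace ℝ X] (x : X) :
    Set (X →L[ℝ] ℝ) := {g | ‖g‖ = 1 ∧ g x = 1}

/-- A point of the unit sphere is smooth if it has exactly one support functional. -/
def IsSmoothPt {X : Type*} [NormedAddCommGroup X] [NormedSpace ℝ X] (x : X) : Prop :=
  ∃ g : X →L[ℝ] ℝ, suppFn X x = {g}

/-- `D_y = {x ∈ S_X : ‖x + y‖ < 2}`. -/
def Dset {X : Type*} [NormedAddCommGroup X] [NormedSpace ℝ X] (y : X) : Set X :=
  {x | x ∈ sphere (0 : X) 1 ∧ ‖x + y‖ < 2}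

/-- `W_y`: points `x ∈ D_y` with `(x-y)/‖x-y‖` smooth in `X` and
`(f x - f y)/‖f x - f y‖` smooth in `E`. -/
def Wset {X E : Type*} [NormedAddCommGroup X] [NormedSpace ℝ X]
    [NormedAddCommGroup E] [NormedSpace ℝ E] (f : X → E) (y : X) : Set X :=
  {x | x ∈ Dset y ∧ IsSmoothPt (unitDir (x - y)) ∧ IsSmoothPt (unitDir (f x - f y))}

/-- `Λ_y`: the set of limit points of `(y - z)/‖y - z‖` as `z → y`, `z ∈ S_X`, `z ≠ y`. -/
def tangentDirs {X : Type*} [NormedAddCommGroup X] [NormedSpace ℝ X] (y : X) : Set X :=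
  {u | ∃ z : ℕ → X, (∀ n, z n ∈ sphere (0 : X) 1 ∧ z n ≠ y) ∧
    Tendsto z atTop (𝓝 y) ∧ Tendsto (fun n => unitDir (y - z n)) atTop (𝓝 u)}

/-- A linear map `T` represents the tangent action of `f` at `y`: whenever `y_n → y` on the
sphere with `(y - y_n)/‖y - y_n‖ → u`, one has `(f y - f y_n)/‖f y - f y_n‖ → T u`. -/
def RepTangent {X E : Type*} [NormedAddCommGroup X] [NormedSpace ℝ X]
    [NormedAddCommGroup E] [NormedSpace ℝ E] (f : X → E) (y : X) (T : X →ₗ[ℝ] E) : Prop :=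
  ∀ (z : ℕ → X) (u : X), (∀ n, z n ∈ sphere (0 : X) 1 ∧ z n ≠ y) →
    Tendsto z atTop (𝓝 y) → Tendsto (fun n => unitDir (y - z n)) atTop (𝓝 u) →
    Tendsto (fun n => unitDir (f y - f (z n))) atTop (𝓝 (T u))

/-- The positively homogeneous extension `F` of `f`: `F 0 = 0`, `F x = ‖x‖ • f (x/‖x‖)`. -/
def homExt {X E : Type*} [NormedAddCommGroup X] [NormedSpace ℝ X]
    [NormedAddCommGroup E] [NormedSpace ℝ E] (f : X → E) (x : X) : E :=
  ‖x‖ • f (unitDir x)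

/-- `F` is Gateaux differentiable at `y`: all one-sided directional derivatives exist and
depend linearly (and continuously) on the direction. -/
def GateauxAt {X E : Type*} [NormedAddCommGroup X] [NormedSpace ℝ X]
    [NormedAddCommGroup E] [NormedSpace ℝ E] (F : X → E) (y : X) : Prop :=
  ∃ L : X →L[ℝ] E, ∀ z : X,
    Tendsto (fun a : ℝ => a⁻¹ • (F (y + a • z) - F y)) (𝓝[>] 0) (𝓝 (L z))

section Facets

variable {X : Type*} [NormedAddCommGroup X] [NormedSpace ℝ X]

/-- The functionals that are the unique support functional at some point of the unit sphere;
when there are finitely many of them they define the facets of the unit ball. -/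
def facetFn (X : Type*) [NormedAddCommGroup X] [NormedSpace ℝ X] : Set (X →L[ℝ] ℝ) :=
  {g | ∃ x : X, ‖x‖ = 1 ∧ suppFn X x = {g}}

lemma le_norm_of_norm_eq_one {g : X →L[ℝ] ℝ} (hg : ‖g‖ = 1) (x : X) : g x ≤ ‖x‖ := by
  have := (le_abs_self _).trans (g.le_opNorm x)
  rwa [hg, one_mul] at this

lemma norm_eq_one_of_mem_facetFn {g : X →L[ℝ] ℝ} (hg : g ∈ facetFn X) : ‖g‖ = 1 := by
  obtain ⟨x, -, hx⟩ := hg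
  exact (hx.symm.subset rfl : g ∈ suppFn X x).1

lemma le_norm_of_mem_facetFn {g : X →L[ℝ] ℝ} (hg : g ∈ facetFn X) (x : X) : g x ≤ ‖x‖ :=
  le_norm_of_norm_eq_one (norm_eq_one_of_mem_facetFn hg) x

lemma neg_mem_facetFn {g : X →L[ℝ] ℝ} (hg : g ∈ facetFn X) : -g ∈ facetFn X := by
  obtain ⟨x, hx, hs⟩ := hg
  refine ⟨-x, by simpa using hx, ?_⟩
  ext h
  have := Set.ext_iff.1 hs (-h)
  simp only [suppFn, mem_ofPred_eq, mem_singleton_iff, norm_neg, neg_apply,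
    map_neg] at this ⊢
  rw [this, neg_eq_iff_eq_neg]

/-- A point of the sphere at which the facet functional `g` is the only active one. -/
lemma exists_unique_active {g : X →L[ℝ] ℝ} (hg : g ∈ facetFn X) :
    ∃ x : X, ‖x‖ = 1 ∧ g x = 1 ∧ ∀ g' ∈ facetFn X, g' x = 1 → g' = g := by
  obtain ⟨x, hx, hs⟩ := hg
  refine ⟨x, hx, (hs.symm.subset rfl : g ∈ suppFn X x).2, fun g' hg' h => ?_⟩
  exact hs.subset (⟨norm_eq_one_of_mem_facetFn hg', h⟩ : g' ∈ suppFn X x)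

lemma finite_facetFn {s : Finset X} (hs : closedBall (0 : X) 1 = convexHull ℝ (s : Set X)) :
    (facetFn X).Finite := by
  classical
  refine Set.Finite.of_injOn (f := fun g : X →L[ℝ] ℝ => s.filter (fun v => g v = 1))
    (t := (s.powerset : Set (Finset X))) 
    (fun g _ => Finset.mem_coe.2 (Finset.mem_powerset.2 (Finset.filter_subset _ _))) ?_
    (Finset.finite_toSet _)
  rintro g ⟨x, hx, hgx⟩ g' hg' h
  have hg := (hgx.symm.subset rfl : g ∈ suppFn X x)
  have hxs : x ∈ convexHull ℝ (s : Set X) := hs ▸ by simp [hx]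
  obtain ⟨w, hw0, hw1, hwx⟩ := Finset.mem_convexHull'.1 hxs
  have hle : ∀ v ∈ s, g v ≤ 1 := fun v hv => by
    have hv' : v ∈ closedBall (0 : X) 1 := hs ▸ subset_convexHull ℝ _ hv
    exact (le_norm_of_norm_eq_one hg.1 v).trans (by simpa using hv')
  have hsum : ∑ v ∈ s, w v * (1 - g v) = 0 := by
    have : g x = ∑ v ∈ s, w v * g v := by rw [← hwx]; simp
    simp only [mul_sub, mul_one, Finset.sum_sub_distrib, hw1, ← this, hg.2, sub_self]
  have hz := (Finset.sum_eq_zero_iff_of_nonneg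
    (fun v hv => mul_nonneg (hw0 v hv) (sub_nonneg.2 (hle v hv)))).1 hsum
  have hg'x : g' x = 1 := by
    rw [← hwx, map_sum, ← hw1]
    refine Finset.sum_congr rfl fun v hv => ?_
    rcases mul_eq_zero.1 (hz v hv) with h0 | h0
    · simp [h0]
    · have hv' : v ∈ s.filter (fun v => g' v = 1) := by
        rw [← (show s.filter (fun v => g v = 1) = s.filter (fun v => g' v = 1) from h)]
        exact Finset.mem_filter.2 ⟨hv, by linarith⟩
      simp [(Finset.mem_filter.1 hv').2]
  exact (hgx.subset (⟨norm_eq_one_of_mem_facetFn hg', hg'x⟩ : g' ∈ suppFn X x)).symm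

/-- Points with exactly one support functional are dense. -/
lemma dense_exists_suppFn_eq_singleton [FiniteDimensional ℝ X] [Nontrivial X] :
    Dense {x : X | x ≠ 0 ∧ ∃ g, suppFn X (unitDir x) = {g}} := by
  borelize X
  have hd : Dense {x : X | DifferentiableAt ℝ (fun x : X => ‖x‖) x} :=
    Measure.dense_of_ae (μ := Measure.addHaar)
      (lipschitzWith_one_norm.ae_differentiableAt)
  have h0 : Dense ({0}ᶜ : Set X) := dense_compl_singleton 0
  refine (hd.inter_of_isOpen_right h0 isOpen_compl_singleton).mono ?_
  rintro x ⟨hx, hx0⟩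
  have hx0 : x ≠ 0 := hx0
  refine ⟨hx0, ?_⟩
  have key : ∀ g ∈ suppFn X (unitDir x), g = fderiv ℝ (fun x : X => ‖x‖) x := by
    rintro g ⟨hg1, hg2⟩
    have hgx : g x = ‖x‖ := by
      have : ‖x‖⁻¹ * g x = 1 := by simpa [unitDir] using hg2
      field_simp at this
      linarith
    have hmin : IsLocalMin (fun y : X => ‖y‖ - g y) x := by
      refine Eventually.of_forall fun y => ?_
      have := le_norm_of_norm_eq_one hg1 y
      simp only [hgx, sub_self]
      linarith
    have hz := hmin.fderiv_eq_zero
    rw [fderiv_fun_sub hx g.differentiableAt, g.fderiv] at hz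
    exact (sub_eq_zero.1 hz).symm
  obtain ⟨g, hg1, hg2⟩ := exists_dual_vector ℝ x (norm_ne_zero_iff.2 hx0)
  have hg : g ∈ suppFn X (unitDir x) := by
    refine ⟨hg1, ?_⟩
    have : g x = ‖x‖ := by simpa using hg2
    simp [unitDir, this, norm_ne_zero_iff.2 hx0]
  exact ⟨g, subset_antisymm (fun h hh => (key h hh).trans (key g hg).symm) (by simpa using hg)⟩

lemma norm_unitDir {x : X} (hx : x ≠ 0) : ‖unitDir x‖ = 1 := by
  simp [unitDir, norm_smul, norm_ne_zero_iff.2 hx]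

lemma norm_smul_unitDir (x : X) : ‖x‖ • unitDir x = x := by
  rcases eq_or_ne x 0 with rfl | hx
  · simp
  · simp [unitDir, smul_smul, norm_ne_zero_iff.2 hx]

lemma exists_mem_facetFn_eq_norm [FiniteDimensional ℝ X] [Nontrivial X]
    (hfin : (facetFn X).Finite) (x : X) : ∃ g ∈ facetFn X, g x = ‖x‖ := by
  have hcl : IsClosed (⋃ g ∈ facetFn X, {x : X | g x = ‖x‖}) :=
    hfin.isClosed_biUnion fun g _ => isClosed_eq g.continuous continuous_norm
  have hsub : {x : X | x ≠ 0 ∧ ∃ g, suppFn X (unitDir x) = {g}} ⊆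
      ⋃ g ∈ facetFn X, {x : X | g x = ‖x‖} := by
    rintro x ⟨hx0, g, hg⟩
    refine mem_iUnion₂.2 ⟨g, ⟨unitDir x, norm_unitDir hx0, hg⟩, ?_⟩
    have := (hg.symm.subset rfl : g ∈ suppFn X (unitDir x)).2
    calc g x = g (‖x‖ • unitDir x) := by rw [norm_smul_unitDir]
      _ = ‖x‖ := by rw [map_smul, this, smul_eq_mul, mul_one]
  have := hcl.closure_subset_iff.2 hsub (dense_exists_suppFn_eq_singleton x)
  simpa using this

lemma eventually_active (hfin : (facetFn X).Finite) (y : X) :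
    ∀ᶠ z in 𝓝 y, ∀ g ∈ facetFn X, g z = ‖z‖ → g y = ‖y‖ := by
  refine (eventually_all_finite hfin).2 fun g _ => ?_
  by_cases h : g y = ‖y‖
  · exact Eventually.of_forall fun _ _ => h
  · have hc : ContinuousAt (fun z => g z - ‖z‖) y := by fun_prop
    filter_upwards [hc.eventually_ne (sub_ne_zero.2 h)] with z hz hz'
    exact absurd (sub_eq_zero.2 hz') hz

/-- Near a point with a single active facet functional, the norm is that functional. -/
lemma eventually_norm_eq [FiniteDimensional ℝ X] [Nontrivial X]
    (hfin : (facetFn X).Finite) {g : X →L[ℝ] ℝ} {y : X}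
    (hy : ∀ g' ∈ facetFn X, g' y = ‖y‖ → g' = g) : ∀ᶠ z in 𝓝 y, g z = ‖z‖ := by
  filter_upwards [eventually_active hfin y] with z hz
  obtain ⟨g', hg', h⟩ := exists_mem_facetFn_eq_norm hfin z
  rwa [← hy g' hg' (hz g' hg' h)]

/-- Two points of the sphere at distance `2`, one of them smooth. -/
lemma norm_sub_eq_two_iff {x w : X} {g : X →L[ℝ] ℝ} (hx : ‖x‖ = 1) (hw : ‖w‖ = 1)
    (hg : suppFn X x = {g}) : ‖x - w‖ = 2 ↔ g w = -1 := by
  have hgx := (hg.symm.subset rfl : g ∈ suppFn X x)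
  constructor
  · intro h
    obtain ⟨k, hk1, hk2⟩ := exists_dual_vector ℝ (x - w) (by rw [h]; norm_num)
    have h1 := le_norm_of_norm_eq_one hk1 x
    have h2 := le_norm_of_norm_eq_one hk1 (-w)
    have h3 : k x - k w = 2 := by simpa [h] using hk2
    rw [map_neg, norm_neg] at h2
    have : k = g := hg.subset (⟨hk1, by linarith⟩ : k ∈ suppFn X x)
    rw [← this]
    linarith
  · intro h
    refine le_antisymm ((norm_sub_le x w).trans (by rw [hx, hw]; norm_num)) ?_
    have := le_norm_of_norm_eq_one hgx.1 (x - w)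
    rw [map_sub, hgx.2, h] at this
    linarith

end Facets

section Midpoints

variable {X E : Type*} [NormedAddCommGroup X] [NormedAddCommGroup E]

/-- Nested metric neighbourhoods in `S` shrinking to the midpoint of `a` and `b`. -/
def midSets (S : Set X) (a b : X) : ℕ → Set X
  | 0 => {w ∈ S | ‖w - a‖ = ‖a - b‖ / 2 ∧ ‖w - b‖ = ‖a - b‖ / 2}
  | n + 1 => {w ∈ midSets S a b n |
      ∀ w' ∈ midSets S a b n, ‖w - w'‖ ≤ ‖a - b‖ * 2⁻¹ ^ (n + 1)}

lemma midSets_subset_zero (S : Set X) (a b : X) (n : ℕ) : midSets S a b n ⊆ midSets S a b 0 := by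
  induction n with
  | zero => exact subset_rfl
  | succ n ih => exact (sep_subset _ _).trans ih

lemma norm_sub_le_of_mem_midSets {S : Set X} {a b w w' : X} {n : ℕ}
    (hw : w ∈ midSets S a b n) (hw' : w' ∈ midSets S a b n) :
    ‖w - w'‖ ≤ ‖a - b‖ * 2⁻¹ ^ n := by
  cases n with
  | zero =>
    have := norm_sub_le_norm_sub_add_norm_sub w a w'
    rw [hw.2.1, norm_sub_rev a w', hw'.2.1] at this
    simpa using this
  | succ n => exact hw.2 w' hw'.1

lemma mem_midSets_iff {f : X → E} {S : Set X} {S' : Set E} (hbij : BijOn f S S')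
    (hiso : ∀ x ∈ S, ∀ x' ∈ S, ‖f x - f x'‖ = ‖x - x'‖) {a b : X} (ha : a ∈ S) (hb : b ∈ S)
    (n : ℕ) : ∀ w ∈ S, f w ∈ midSets S' (f a) (f b) n ↔ w ∈ midSets S a b n := by
  have hS : ∀ k, midSets S a b k ⊆ S := fun k => (midSets_subset_zero S a b k).trans
    (sep_subset _ _)
  have hS' : ∀ k, midSets S' (f a) (f b) k ⊆ S' := fun k =>
    (midSets_subset_zero S' (f a) (f b) k).trans (sep_subset _ _)
  induction n with
  | zero =>
    intro w hw
    simp only [midSets, mem_ofPred_eq, hiso w hw a ha, hiso w hw b hb, hiso a ha b hb, hw,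
      hbij.mapsTo hw]
  | succ n ih =>
    intro w hw
    simp only [midSets, mem_ofPred_eq, ih w hw, hiso a ha b hb]
    refine and_congr_right fun _ => ⟨fun h v hv => ?_, fun h v hv => ?_⟩
    · rw [← hiso w hw v (hS n hv)]
      exact h _ ((ih v (hS n hv)).2 hv)
    · obtain ⟨u, hu, rfl⟩ := hbij.surjOn (hS' n hv)
      rw [hiso w hw u hu]
      exact h _ ((ih u hu).1 hv)

variable [NormedSpace ℝ X] [NormedSpace ℝ E]

/-- A continuous curve which is locally midpoint-preserving is affine. -/
lemma eq_lineMap_of_locally_midpoint {φ : ℝ → E} (hc : ContinuousOn φ (Icc 0 1))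
    (hm : ∀ t ∈ Ioo (0 : ℝ) 1, ∀ᶠ δ in 𝓝[>] (0 : ℝ), φ (t + δ) + φ (t - δ) = (2 : ℝ) • φ t)
    {t : ℝ} (ht : t ∈ Icc (0 : ℝ) 1) : φ t = (1 - t) • φ 0 + t • φ 1 := by
  set ψ : ℝ → E := fun t => φ t - ((1 - t) • φ 0 + t • φ 1) with hψ
  have hψc : ContinuousOn (fun t => ‖ψ t‖) (Icc 0 1) := by
    refine (hc.sub (Continuous.continuousOn ?_)).norm
    fun_prop
  obtain ⟨t₀, ht₀, hmax⟩ := isCompact_Icc.exists_isMaxOn ⟨t, ht⟩ hψc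
  by_contra hne
  have hpos : 0 < ‖ψ t₀‖ := (norm_pos_iff.2 (sub_ne_zero.2 hne)).trans_le (hmax ht)
  obtain ⟨s, ⟨hs, hsM⟩, hleast⟩ :=
    (isCompact_Icc.of_isClosed_subset (hψc.preimage_isClosed_of_isClosed isClosed_Icc
      (isClosed_singleton (x := ‖ψ t₀‖))) inter_subset_left).exists_isLeast ⟨t₀, ht₀, rfl⟩
  have hsM : ‖ψ s‖ = ‖ψ t₀‖ := hsM
  have hs0 : s ≠ 0 := by
    rintro rfl
    simp [hψ] at hsM
    exact hpos.ne hsM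
  have hs1 : s ≠ 1 := by
    rintro rfl
    simp [hψ] at hsM
    exact hpos.ne hsM
  have hsI : s ∈ Ioo (0 : ℝ) 1 := ⟨hs.1.lt_of_ne hs0.symm, hs.2.lt_of_ne hs1⟩
  have hsmall : ∀ᶠ δ in 𝓝[>] (0 : ℝ), δ ∈ Ioo 0 (min s (1 - s)) :=
    Ioo_mem_nhdsGT (lt_min hsI.1 (sub_pos.2 hsI.2))
  obtain ⟨δ, hδ, hδ0, hδs⟩ := ((hm s hsI).and hsmall).exists
  have hδ1 := hδs.trans_le (min_le_left _ _)
  have hδ2 := hδs.trans_le (min_le_right _ _)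
  have hmem1 : s + δ ∈ Icc (0 : ℝ) 1 := ⟨by linarith, by linarith⟩
  have hmem2 : s - δ ∈ Icc (0 : ℝ) 1 := ⟨by linarith, by linarith⟩
  have hsum : (2 : ℝ) • ψ s = ψ (s + δ) + ψ (s - δ) := by
    simp only [hψ, smul_sub, ← hδ]
    module
  have hle : 2 * ‖ψ s‖ ≤ ‖ψ (s + δ)‖ + ‖ψ (s - δ)‖ := by
    have := norm_add_le (ψ (s + δ)) (ψ (s - δ))
    rwa [← hsum, norm_smul, Real.norm_ofNat] at this
  have h1 : ‖ψ (s + δ)‖ ≤ ‖ψ t₀‖ := hmax hmem1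
  have h2 : ‖ψ (s - δ)‖ ≤ ‖ψ t₀‖ := hmax hmem2
  have := hleast ⟨hmem2, (by linarith : ‖ψ (s - δ)‖ = ‖ψ t₀‖)⟩
  linarith

lemma reflect_mem_midSets {S : Set X} {a b m : X} (hab : a + b = (2 : ℝ) • m)
    (hsym : ∀ w ∈ S, ‖w - m‖ ≤ ‖a - b‖ → (2 : ℝ) • m - w ∈ S) (n : ℕ) :
    ∀ w ∈ midSets S a b n, (2 : ℝ) • m - w ∈ midSets S a b n := by
  induction n with
  | zero =>
    rintro w ⟨hwS, hwa, hwb⟩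
    have ham : ‖a - m‖ = ‖a - b‖ / 2 := by
      have : a - m = (2⁻¹ : ℝ) • (a - b) := by
        have : m = (2⁻¹ : ℝ) • (a + b) := by rw [hab]; module
        rw [this]; module
      rw [this, norm_smul]; norm_num; ring
    refine ⟨hsym w hwS ?_, ?_, ?_⟩
    · have := norm_sub_le_norm_sub_add_norm_sub w a m
      linarith
    · rw [← hab, ← hwb, norm_sub_rev w]; congr 1; abel
    · rw [← hab, ← hwa, norm_sub_rev w]; congr 1; abel
  | succ n ih =>
    rintro w ⟨hw, hw'⟩
    refine ⟨ih w hw, fun v hv => ?_⟩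
    have := hw' _ (ih v hv)
    rwa [norm_sub_rev, show (2 : ℝ) • m - v - w = (2 : ℝ) • m - w - v by abel] at this

lemma midpoint_mem_midSets {S : Set X} {a b m : X} (hm : m ∈ S) (hab : a + b = (2 : ℝ) • m)
    (hsym : ∀ w ∈ S, ‖w - m‖ ≤ ‖a - b‖ → (2 : ℝ) • m - w ∈ S) (n : ℕ) :
    m ∈ midSets S a b n := by
  have hm2 : m = (2⁻¹ : ℝ) • (a + b) := by rw [hab]; module
  induction n with
  | zero =>
    refine ⟨hm, ?_, ?_⟩
    · rw [show m - a = (-2⁻¹ : ℝ) • (a - b) by rw [hm2]; module, norm_smul]; norm_num; ring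
    · rw [show m - b = (2⁻¹ : ℝ) • (a - b) by rw [hm2]; module, norm_smul]; norm_num; ring
  | succ n ih =>
    refine ⟨ih, fun w hw => ?_⟩
    have := norm_sub_le_of_mem_midSets (reflect_mem_midSets hab hsym n w hw) hw
    rw [show (2 : ℝ) • m - w - w = (2 : ℝ) • (m - w) by module, norm_smul,
      Real.norm_ofNat] at this
    rw [pow_succ]
    linarith

/-- A local version of the Mazur–Ulam theorem. -/
lemma map_eq_midpoint {f : X → E} {S : Set X} {S' : Set E} (hbij : BijOn f S S')
    (hiso : ∀ x ∈ S, ∀ x' ∈ S, ‖f x - f x'‖ = ‖x - x'‖) {a b m : X} {m' : E}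
    (ha : a ∈ S) (hb : b ∈ S) (hm : m ∈ S) (hm' : m' ∈ S')
    (hab : a + b = (2 : ℝ) • m) (hab' : f a + f b = (2 : ℝ) • m')
    (hsym : ∀ w ∈ S, ‖w - m‖ ≤ ‖a - b‖ → (2 : ℝ) • m - w ∈ S)
    (hsym' : ∀ w ∈ S', ‖w - m'‖ ≤ ‖f a - f b‖ → (2 : ℝ) • m' - w ∈ S') : f m = m' := by
  have hle : ∀ n : ℕ, ‖f m - m'‖ ≤ ‖f a - f b‖ * 2⁻¹ ^ n := fun n =>
    norm_sub_le_of_mem_midSets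
      ((mem_midSets_iff hbij hiso ha hb n m hm).2 (midpoint_mem_midSets hm hab hsym n))
      (midpoint_mem_midSets hm' hab' hsym' n)
  have hlim : Tendsto (fun n : ℕ => ‖f a - f b‖ * (2⁻¹ : ℝ) ^ n) atTop (𝓝 0) := by
    simpa using (tendsto_pow_atTop_nhds_zero_of_lt_one (by norm_num)
      (by norm_num : (2⁻¹ : ℝ) < 1)).const_mul ‖f a - f b‖
  have := ge_of_tendsto' hlim hle
  exact sub_eq_zero.1 (norm_le_zero_iff.1 this)

end Midpoints

lemma ne_zero_of_norm_eq_one {X : Type*} [NormedAddCommGroup X] {x : X} (hx : ‖x‖ = 1) :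
    x ≠ 0 :=
  norm_ne_zero_iff.1 (by rw [hx]; exact one_ne_zero)

section Facets

variable {X : Type*} [NormedAddCommGroup X] [NormedSpace ℝ X]

lemma continuousAt_unitDir {x : X} (hx : x ≠ 0) : ContinuousAt (unitDir : X → X) x :=
  (continuous_norm.continuousAt.inv₀ (norm_ne_zero_iff.2 hx)).smul continuousAt_id

lemma unitDir_of_norm_eq_one {x : X} (hx : ‖x‖ = 1) : unitDir x = x := by simp [unitDir, hx]

variable [FiniteDimensional ℝ X] [Nontrivial X]

lemma eventually_norm_eq_sub (hfin : (facetFn X).Finite) {g : X →L[ℝ] ℝ} (hg : g ∈ facetFn X)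
    {x y : X} (hx : ‖x‖ = 1) (hy : ‖y‖ = 1) (hgx : g x = -1) (hgy : g y = 1)
    (huniq : ∀ g' ∈ facetFn X, g' x = -1 → g' = g) : ∀ᶠ u in 𝓝 (y - x), g u = ‖u‖ := by
  refine eventually_norm_eq hfin fun g' hg' h => huniq g' hg' ?_
  have h1 := le_norm_of_mem_facetFn hg (y - x)
  have h2 := le_norm_of_mem_facetFn hg' y
  have h3 := le_norm_of_mem_facetFn hg' (-x)
  rw [map_sub] at h h1
  rw [map_neg, norm_neg] at h3
  linarith

/-- The face of a nonzero point contains a vertex. -/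
lemma exists_vertex (hfin : (facetFn X).Finite) {y : X} (hy : y ≠ 0) :
    ∃ y' : X, ‖y'‖ = 1 ∧ (∀ g ∈ facetFn X, g y = ‖y‖ → g y' = 1) ∧
      ∀ u, (∀ g ∈ facetFn X, g y' = 1 → g u = 0) → u = 0 := by
  set K : Set X := closedBall 0 1 ∩ ⋂ g ∈ {g ∈ facetFn X | g y = ‖y‖}, {w | g w = 1} with hK
  have hKc : IsCompact K := (isCompact_closedBall (0 : X) 1).inter_right
    (isClosed_biInter fun g _ => isClosed_eq g.continuous continuous_const)
  have hKmem : ∀ w, w ∈ K ↔ ‖w‖ ≤ 1 ∧ ∀ g ∈ facetFn X, g y = ‖y‖ → g w = 1 := by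
    simp [hK]
  have hy0 := norm_ne_zero_iff.2 hy
  have hne : K.Nonempty := by
    refine ⟨unitDir y, (hKmem _).2 ⟨(norm_unitDir hy).le, fun g _ h => ?_⟩⟩
    rw [unitDir, map_smul, h, smul_eq_mul, inv_mul_cancel₀ hy0]
  obtain ⟨y', hy'K, hext⟩ := hKc.extremePoints_nonempty hne
  obtain ⟨hle, hact⟩ := (hKmem y').1 hy'K
  obtain ⟨g₀, hg₀, hg₀y⟩ := exists_mem_facetFn_eq_norm hfin y
  have hnorm : ‖y'‖ = 1 := le_antisymm hle (by
    rw [← hact g₀ hg₀ hg₀y]; exact le_norm_of_mem_facetFn hg₀ y')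
  refine ⟨y', hnorm, hact, fun u hu => ?_⟩
  have hmemK : ∀ v, (∀ g ∈ facetFn X, g y' = 1 → g v = 0) →
      (∀ g ∈ facetFn X, g (y' + v) = ‖y' + v‖ → g y' = ‖y'‖) → y' + v ∈ K := by
    intro v hv hva
    obtain ⟨g, hg, hgv⟩ := exists_mem_facetFn_eq_norm hfin (y' + v)
    have hgy' := hva g hg hgv
    rw [hnorm] at hgy'
    refine (hKmem _).2 ⟨?_, fun k hk hky => ?_⟩
    · rw [← hgv, map_add, hgy', hv g hg hgy', add_zero]
    · rw [map_add, hact k hk hky, hv k hk (hact k hk hky), add_zero]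
  have hlim : Tendsto (fun t : ℝ => y' + t • u) (𝓝[>] 0) (𝓝 y') := by
    have : ContinuousAt (fun t : ℝ => y' + t • u) 0 := by fun_prop
    simpa using this.tendsto.mono_left nhdsWithin_le_nhds
  have hlim' : Tendsto (fun t : ℝ => y' + -(t • u)) (𝓝[>] 0) (𝓝 y') := by
    have : ContinuousAt (fun t : ℝ => y' + -(t • u)) 0 := by fun_prop
    simpa using this.tendsto.mono_left nhdsWithin_le_nhds
  obtain ⟨t, ⟨h1, h2⟩, ht⟩ := (((hlim.eventually (eventually_active hfin y')).and
    (hlim'.eventually (eventually_active hfin y'))).and self_mem_nhdsWithin).exists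
  have ht : 0 < t := ht
  have hk1 := hmemK _ (fun g hg hgy => by simp [hu g hg hgy]) h1
  have hk2 := hmemK _ (fun g hg hgy => by simp [hu g hg hgy]) h2
  have heq := hext hk1 hk2 ⟨1 / 2, 1 / 2, by norm_num, by norm_num, by norm_num, by module⟩
  have : t • u = 0 := by simpa using heq
  exact (smul_eq_zero.1 this).resolve_left ht.ne'

end Facets

section HomExt

variable {X E : Type*} [NormedAddCommGroup X] [NormedSpace ℝ X]
  [NormedAddCommGroup E] [NormedSpace ℝ E]

lemma homExt_zero (f : X → E) : homExt f 0 = 0 := by simp [homExt]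

lemma homExt_of_norm_eq_one (f : X → E) {x : X} (hx : ‖x‖ = 1) : homExt f x = f x := by
  rw [homExt, unitDir_of_norm_eq_one hx, hx, one_smul]

lemma homExt_smul (f : X → E) {c : ℝ} (hc : 0 ≤ c) (x : X) :
    homExt f (c • x) = c • homExt f x := by
  rcases hc.eq_or_lt with rfl | hc
  · simp [homExt]
  · have : unitDir (c • x) = unitDir x := by
      rw [unitDir, unitDir, norm_smul, Real.norm_of_nonneg hc.le, smul_smul, mul_inv]
      congr 1
      field_simp
    rw [homExt, homExt, this, norm_smul, Real.norm_of_nonneg hc.le, mul_smul]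

lemma homExt_neg_comp_neg (f : X → E) (x : X) :
    homExt (fun x => -f (-x)) x = -homExt f (-x) := by
  simp [homExt, unitDir]

end HomExt

/-- `ε` matches the facets of the unit ball of `X` with those of the unit ball of `E`, in
accordance with the bijective isometry `f` between the unit spheres. -/
structure FacetCorrespondence {X E : Type*} [NormedAddCommGroup X] [NormedSpace ℝ X]
    [NormedAddCommGroup E] [NormedSpace ℝ E] (f : X → E)
    (ε : (X →L[ℝ] ℝ) → (E →L[ℝ] ℝ)) : Prop where
  bij : BijOn f (sphere (0 : X) 1) (sphere (0 : E) 1)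
  iso : ∀ x ∈ sphere (0 : X) 1, ∀ x' ∈ sphere (0 : X) 1, ‖f x - f x'‖ = ‖x - x'‖
  finite : (facetFn X).Finite
  mem : ∀ g ∈ facetFn X, ε g ∈ facetFn E
  surj : ∀ e ∈ facetFn E, ∃ g ∈ facetFn X, ε g = e
  eq_one_iff : ∀ g ∈ facetFn X, ∀ w : X, ‖w‖ = 1 → (ε g (f w) = 1 ↔ g w = 1)
  eq_neg_one_iff : ∀ g ∈ facetFn X, ∀ w : X, ‖w‖ = 1 → (ε g (f w) = -1 ↔ g w = -1)

section Existence

variable {X E : Type*} [NormedAddCommGroup X] [NormedSpace ℝ X] [FiniteDimensional ℝ X]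
  [NormedAddCommGroup E] [NormedSpace ℝ E] [FiniteDimensional ℝ E] [Nontrivial X] [Nontrivial E]

lemma exists_facet_image (hfin : (facetFn X).Finite) {f : X → E}
    (hbij : BijOn f (sphere (0 : X) 1) (sphere (0 : E) 1))
    (hiso : ∀ x ∈ sphere (0 : X) 1, ∀ x' ∈ sphere (0 : X) 1, ‖f x - f x'‖ = ‖x - x'‖)
    {g : X →L[ℝ] ℝ} (hg : g ∈ facetFn X) :
    ∃ (x : X) (e : E →L[ℝ] ℝ), ‖x‖ = 1 ∧ g x = 1 ∧ suppFn E (f x) = {e} ∧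
      ∀ w : X, ‖w‖ = 1 → (e (f w) = -1 ↔ g w = -1) := by
  simp only [mem_sphere_zero_iff_norm] at hiso
  have hnorm : ∀ x, ‖x‖ = 1 → ‖f x‖ = 1 := fun x hx => by simpa using hbij.mapsTo (by simpa using hx)
  obtain ⟨x₀, hx₀, -, huniq⟩ := exists_unique_active hg
  obtain ⟨r, hr, hball⟩ := Metric.eventually_nhds_iff_ball.1 (eventually_active hfin x₀)
  have hf0 := ne_zero_of_norm_eq_one (hnorm x₀ hx₀)
  have hcont : ∀ᶠ z in 𝓝 (f x₀), unitDir z ∈ ball (f x₀) r := by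
    have := (continuousAt_unitDir hf0).tendsto
    rw [unitDir_of_norm_eq_one (hnorm x₀ hx₀)] at this
    exact this.eventually (ball_mem_nhds _ hr)
  obtain ⟨z, ⟨hz0, e, he⟩, hzr⟩ := ((mem_closure_iff_frequently.1
    (dense_exists_suppFn_eq_singleton (f x₀))).and_eventually hcont).exists
  obtain ⟨x, hx, hxz⟩ := hbij.surjOn
    (mem_sphere_zero_iff_norm.2 (norm_unitDir hz0) : unitDir z ∈ sphere (0 : E) 1)
  rw [mem_sphere_zero_iff_norm] at hx
  have hxr : x ∈ ball x₀ r := by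
    rw [mem_ball, dist_eq_norm, ← hiso x hx x₀ hx₀, hxz, ← dist_eq_norm]
    exact hzr
  have hact : ∀ g' ∈ facetFn X, g' x = 1 → g' = g := fun g' hg' h =>
    huniq g' hg' ((hball x hxr g' hg' (h.trans hx.symm)).trans hx₀)
  have hgx : g x = 1 := by
    obtain ⟨g', hg', h⟩ := exists_mem_facetFn_eq_norm hfin x
    rw [hx] at h
    rwa [← hact g' hg' h]
  refine ⟨x, e, hx, hgx, hxz ▸ he, fun w hw => ?_⟩
  rw [← norm_sub_eq_two_iff (hnorm x hx) (hnorm w hw) (hxz ▸ he), hiso x hx w hw]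
  constructor
  · intro h
    obtain ⟨g', hg', h'⟩ := exists_mem_facetFn_eq_norm hfin (x - w)
    have h1 := le_norm_of_mem_facetFn hg' x
    have h2 := le_norm_of_mem_facetFn hg' (-w)
    rw [map_neg, norm_neg] at h2
    rw [map_sub, h] at h'
    rw [← hact g' hg' (by linarith)]
    linarith
  · intro h
    refine le_antisymm ((norm_sub_le x w).trans (by rw [hx, hw]; norm_num)) ?_
    have := le_norm_of_mem_facetFn hg (x - w)
    rw [map_sub, hgx, h] at this
    linarith

lemma exists_facetCorrespondence (hfin : (facetFn X).Finite) {f : X → E}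
    (hbij : BijOn f (sphere (0 : X) 1) (sphere (0 : E) 1))
    (hiso : ∀ x ∈ sphere (0 : X) 1, ∀ x' ∈ sphere (0 : X) 1, ‖f x - f x'‖ = ‖x - x'‖) :
    ∃ ε, FacetCorrespondence f ε := by
  have hnorm : ∀ x, ‖x‖ = 1 → ‖f x‖ = 1 := fun x hx => by simpa using hbij.mapsTo (by simpa using hx)
  choose! x e hx hgx hsupp hneg using
    fun g (hg : g ∈ facetFn X) => exists_facet_image hfin hbij hiso hg
  have hmem : ∀ g ∈ facetFn X, e g ∈ facetFn E := fun g hg =>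
    ⟨f (x g), hnorm _ (hx g hg), hsupp g hg⟩
  have hodd : ∀ g ∈ facetFn X, e (-g) = -e g := fun g hg => by
    have hg' := neg_mem_facetFn hg
    have h1 : e (-g) (f (x g)) = -1 := (hneg (-g) hg' _ (hx g hg)).2 (by simp [hgx g hg])
    have h2 : -e (-g) ∈ suppFn E (f (x g)) :=
      ⟨by rw [norm_neg, norm_eq_one_of_mem_facetFn (hmem _ hg')], by simp [h1]⟩
    rw [hsupp g hg, mem_singleton_iff] at h2
    rw [← h2, neg_neg]
  have hone : ∀ g ∈ facetFn X, ∀ w : X, ‖w‖ = 1 → (e g (f w) = 1 ↔ g w = 1) := by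
    intro g hg w hw
    have := hneg (-g) (neg_mem_facetFn hg) w hw
    simpa [hodd g hg] using this
  refine ⟨e, hbij, hiso, hfin, hmem, ?_, hone, hneg⟩
  rintro e' ⟨z, hz, he'⟩
  obtain ⟨w, hw, rfl⟩ := hbij.surjOn (mem_sphere_zero_iff_norm.2 hz)
  rw [mem_sphere_zero_iff_norm] at hw
  obtain ⟨g, hg, hgw⟩ := exists_mem_facetFn_eq_norm hfin w
  refine ⟨g, hg, he'.subset ⟨norm_eq_one_of_mem_facetFn (hmem g hg), ?_⟩⟩
  exact (hone g hg w hw).2 (hgw.trans hw)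

end Existence

namespace FacetCorrespondence

variable {X E : Type*} [NormedAddCommGroup X] [NormedSpace ℝ X]
  [NormedAddCommGroup E] [NormedSpace ℝ E]
  {f : X → E} {ε : (X →L[ℝ] ℝ) → (E →L[ℝ] ℝ)}

lemma norm_map (h : FacetCorrespondence f ε) {x : X} (hx : ‖x‖ = 1) : ‖f x‖ = 1 := by
  simpa using h.bij.mapsTo (mem_sphere_zero_iff_norm.2 hx)

lemma norm_sub_map (h : FacetCorrespondence f ε) {x y : X} (hx : ‖x‖ = 1) (hy : ‖y‖ = 1) :
    ‖f x - f y‖ = ‖x - y‖ :=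
  h.iso x (mem_sphere_zero_iff_norm.2 hx) y (mem_sphere_zero_iff_norm.2 hy)

lemma exists_eq_map (h : FacetCorrespondence f ε) {z : E} (hz : ‖z‖ = 1) :
    ∃ x, ‖x‖ = 1 ∧ f x = z := by
  obtain ⟨x, hx, rfl⟩ := h.bij.surjOn (mem_sphere_zero_iff_norm.2 hz)
  exact ⟨x, mem_sphere_zero_iff_norm.1 hx, rfl⟩

lemma finite_range (h : FacetCorrespondence f ε) : (facetFn E).Finite :=
  (h.finite.image ε).subset fun e he => h.surj e he

lemma neg_comp_neg (h : FacetCorrespondence f ε) :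
    FacetCorrespondence (fun x => -f (-x)) ε where
  bij := by
    refine ⟨fun x hx => ?_, fun x hx y hy hxy => ?_, fun z hz => ?_⟩
    · rw [mem_sphere_zero_iff_norm] at hx ⊢
      rw [norm_neg, h.norm_map (by rwa [norm_neg])]
    · exact neg_injective
        (h.bij.injOn (by simpa using hx) (by simpa using hy) (neg_injective hxy))
    · rw [mem_sphere_zero_iff_norm] at hz
      obtain ⟨x, hx, hxz⟩ := h.exists_eq_map (z := -z) (by rwa [norm_neg])
      exact ⟨-x, by simpa using hx, by simp [hxz]⟩
  iso x hx y hy := by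
    rw [mem_sphere_zero_iff_norm] at hx hy
    rw [neg_sub_neg, h.norm_sub_map (by rwa [norm_neg]) (by rwa [norm_neg]), neg_sub_neg]
  finite := h.finite
  mem := h.mem
  surj := h.surj
  eq_one_iff g hg w hw := by
    have := h.eq_neg_one_iff g hg (-w) (by rwa [norm_neg])
    rwa [map_neg, neg_inj, ← neg_inj, ← map_neg, neg_neg] at this
  eq_neg_one_iff g hg w hw := by
    have := h.eq_one_iff g hg (-w) (by rwa [norm_neg])
    rwa [map_neg, ← neg_inj, ← map_neg, neg_eq_iff_eq_neg (a := g w)] at this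

lemma active_unique (h : FacetCorrespondence f ε) {y : X} (hy : ‖y‖ = 1) {g : X →L[ℝ] ℝ} {c : ℝ}
    (hc : c = 1 ∨ c = -1) (huniq : ∀ g' ∈ facetFn X, g' y = c → g' = g) :
    ∀ e ∈ facetFn E, e (f y) = c → e = ε g := by
  intro e he hey
  obtain ⟨g', hg', rfl⟩ := h.surj e he
  rcases hc with rfl | rfl
  · rw [huniq g' hg' ((h.eq_one_iff g' hg' y hy).1 hey)]
  · rw [huniq g' hg' ((h.eq_neg_one_iff g' hg' y hy).1 hey)]

lemma norm_homExt (h : FacetCorrespondence f ε) (x : X) : ‖homExt f x‖ = ‖x‖ := by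
  rcases eq_or_ne x 0 with rfl | hx
  · simp [homExt]
  · rw [homExt, norm_smul, norm_norm, h.norm_map (norm_unitDir hx), mul_one]

lemma tendsto_map_unitDir (h : FacetCorrespondence f ε) {x : X} (hx : x ≠ 0) :
    Tendsto (fun z => f (unitDir z)) (𝓝 x) (𝓝 (f (unitDir x))) := by
  have hu : Tendsto (fun z => ‖unitDir z - unitDir x‖) (𝓝 x) (𝓝 0) :=
    tendsto_iff_norm_sub_tendsto_zero.1 (continuousAt_unitDir hx)
  refine tendsto_iff_norm_sub_tendsto_zero.2 (hu.congr' ?_)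
  filter_upwards [isOpen_ne.mem_nhds hx] with z hz
  exact (h.norm_sub_map (norm_unitDir hz) (norm_unitDir hx)).symm

lemma continuous_homExt (h : FacetCorrespondence f ε) : Continuous (homExt f) := by
  refine continuous_iff_continuousAt.2 fun x => ?_
  rcases eq_or_ne x 0 with rfl | hx
  · refine tendsto_iff_norm_sub_tendsto_zero.2 ?_
    simp only [homExt_zero, sub_zero, h.norm_homExt]
    exact tendsto_norm_zero
  · exact continuous_norm.continuousAt.smul (h.tendsto_map_unitDir hx)

variable [FiniteDimensional ℝ E] [Nontrivial E]

/-- The image of a vertex is a vertex. -/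
lemma eq_zero_of_forall_active (h : FacetCorrespondence f ε) {y : X} (hy : ‖y‖ = 1)
    (hvert : ∀ u, (∀ g ∈ facetFn X, g y = 1 → g u = 0) → u = 0) {w : E}
    (hw : ∀ g ∈ facetFn X, g y = 1 → ε g w = 0) : w = 0 := by
  have hl : Tendsto (fun t : ℝ => f y + t • w) (𝓝[>] 0) (𝓝 (f y)) := by
    have : ContinuousAt (fun t : ℝ => f y + t • w) 0 := by fun_prop
    simpa using this.tendsto.mono_left nhdsWithin_le_nhds
  obtain ⟨t, hact, ht⟩ := ((hl.eventually (eventually_active h.finite_range (f y))).and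
    self_mem_nhdsWithin).exists
  have ht : 0 < t := ht
  have hval : ∀ g ∈ facetFn X, g y = 1 → ε g (f y + t • w) = 1 := fun g hg hgy => by
    rw [map_add, map_smul, hw g hg hgy, (h.eq_one_iff g hg y hy).2 hgy]
    simp
  have hnorm : ‖f y + t • w‖ = 1 := by
    obtain ⟨e, he, hez⟩ := exists_mem_facetFn_eq_norm h.finite_range (f y + t • w)
    obtain ⟨g, hg, rfl⟩ := h.surj e he
    rw [← hez]
    exact hval g hg ((h.eq_one_iff g hg y hy).1 ((hact _ he hez).trans (h.norm_map hy)))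
  obtain ⟨p, hp, hpz⟩ := h.exists_eq_map hnorm
  have hpy : p - y = 0 := hvert _ fun g hg hgy => by
    have : g p = 1 := (h.eq_one_iff g hg p hp).1 (hpz ▸ hval g hg hgy)
    rw [map_sub, this, hgy, sub_self]
  rw [sub_eq_zero.1 hpy, left_eq_add] at hpz
  exact (smul_eq_zero.1 hpz).resolve_left ht.ne'

variable [FiniteDimensional ℝ X] [Nontrivial X]

lemma eventually_apply_homExt_eq (h : FacetCorrespondence f ε) {g : X →L[ℝ] ℝ}
    (hg : g ∈ facetFn X) {y : X} (hy : ‖y‖ = 1) (hgy : g y = 1) :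
    ∀ᶠ z in 𝓝 y, ε g (homExt f z) = g z := by
  obtain ⟨x, hx, hgx, huniq⟩ := exists_unique_active (neg_mem_facetFn hg)
  have hgx : g x = -1 := by
    rw [neg_apply] at hgx; linarith
  have huniq' : ∀ g' ∈ facetFn X, g' x = -1 → g' = g := fun g' hg' h' =>
    neg_injective (huniq _ (neg_mem_facetFn hg') (by simp [h']))
  have hy0 := ne_zero_of_norm_eq_one hy
  have hX := eventually_norm_eq_sub h.finite hg hx hy hgx hgy huniq'
  have hεx := (h.eq_neg_one_iff g hg x hx).2 hgx
  have hE := eventually_norm_eq_sub h.finite_range (h.mem g hg) (h.norm_map hx) (h.norm_map hy)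
    hεx ((h.eq_one_iff g hg y hy).2 hgy) (h.active_unique hx (Or.inr rfl) huniq')
  have hlX : Tendsto (fun z => unitDir z - x) (𝓝 y) (𝓝 (y - x)) := by
    simpa [unitDir_of_norm_eq_one hy] using (continuousAt_unitDir hy0).tendsto.sub_const x
  have hlE : Tendsto (fun z => f (unitDir z) - f x) (𝓝 y) (𝓝 (f y - f x)) := by
    simpa [unitDir_of_norm_eq_one hy] using (h.tendsto_map_unitDir hy0).sub_const (f x)
  filter_upwards [hlX.eventually hX, hlE.eventually hE, isOpen_ne.mem_nhds hy0] with z h1 h2 hz0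
  rw [h.norm_sub_map (norm_unitDir hz0) hx, ← h1, map_sub, map_sub, hεx, hgx] at h2
  have h3 : ε g (f (unitDir z)) = g (unitDir z) := by linarith
  calc ε g (homExt f z) = ‖z‖ * ε g (f (unitDir z)) := by simp [homExt]
    _ = g (‖z‖ • unitDir z) := by rw [h3, map_smul, smul_eq_mul]
    _ = g z := by rw [norm_smul_unitDir]

/-- At interior points of a facet, the extension preserves midpoints of small segments of the
facet. -/
lemma eventually_homExt_add_sub (h : FacetCorrespondence f ε) {g : X →L[ℝ] ℝ}
    (hg : g ∈ facetFn X) {y : X} (hy : ‖y‖ = 1) (hgy : g y = 1)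
    (huniq : ∀ g' ∈ facetFn X, g' y = 1 → g' = g) :
    ∀ᶠ u in 𝓝 (0 : X), g u = 0 →
      homExt f (y + u) + homExt f (y - u) = (2 : ℝ) • homExt f y := by
  obtain ⟨r, hr, hX⟩ := Metric.eventually_nhds_iff_ball.1 (eventually_norm_eq h.finite
    (fun g' hg' h' => huniq g' hg' (h'.trans hy)))
  obtain ⟨r', hr', hE⟩ := Metric.eventually_nhds_iff_ball.1 (eventually_norm_eq h.finite_range
    (fun e he h' => h.active_unique hy (Or.inl rfl) huniq e he (h'.trans (h.norm_map hy))))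
  simp only [mem_ball, dist_eq_norm] at hX hE
  filter_upwards [ball_mem_nhds (0 : X) (show 0 < min r r' / 4 by positivity)] with u hu hgu
  rw [mem_ball_zero_iff] at hu
  have hu1 : ‖u‖ < r / 4 := hu.trans_le (by gcongr; exact min_le_left _ _)
  have hu2 : ‖u‖ < r' / 4 := hu.trans_le (by gcongr; exact min_le_right _ _)
  have hu0 := norm_nonneg u
  have hga : g (y + u) = 1 := by rw [map_add, hgy, hgu, add_zero]
  have hgb : g (y - u) = 1 := by rw [map_sub, hgy, hgu, sub_zero]
  have ha : ‖y + u‖ = 1 := by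
    rw [← hX _ (by rw [add_sub_cancel_left]; linarith), hga]
  have hb : ‖y - u‖ = 1 := by
    rw [← hX _ (by rw [sub_sub_cancel_left, norm_neg]; linarith), hgb]
  have hab : ‖y + u - (y - u)‖ = 2 * ‖u‖ := by
    rw [show y + u - (y - u) = (2 : ℝ) • u by module, norm_smul, Real.norm_ofNat]
  set m' : E := (2⁻¹ : ℝ) • (f (y + u) + f (y - u)) with hm'
  have hεm' : ε g m' = 1 := by
    rw [hm', map_smul, map_add, (h.eq_one_iff g hg _ ha).2 hga, (h.eq_one_iff g hg _ hb).2 hgb]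
    norm_num
  have hm'y : ‖m' - f y‖ ≤ ‖u‖ := by
    have h1 := norm_add_le (f (y + u) - f y) (f (y - u) - f y)
    rw [h.norm_sub_map ha hy, h.norm_sub_map hb hy, add_sub_cancel_left, sub_sub_cancel_left,
      norm_neg] at h1
    rw [show m' - f y = (2⁻¹ : ℝ) • (f (y + u) - f y + (f (y - u) - f y)) by rw [hm']; module,
      norm_smul]
    norm_num
    linarith
  have hm'1 : ‖m'‖ = 1 := by rw [← hE m' (by linarith), hεm']
  have key : f y = m' := by
    refine map_eq_midpoint h.bij h.iso (a := y + u) (b := y - u) (by simpa using ha)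
      (by simpa using hb) (by simpa using hy) (by simpa using hm'1) (by module)
      (by rw [hm']; module) (fun w hw hwy => ?_) (fun w hw hwm => ?_)
    · rw [mem_sphere_zero_iff_norm] at hw ⊢
      rw [hab] at hwy
      have h1 : g w = 1 := by rw [hX w (by linarith), hw]
      rw [← hX _ (by
        rw [show (2 : ℝ) • y - w - y = y - w by module, norm_sub_rev]; linarith), map_sub,
        map_smul, h1, hgy]
      norm_num
    · rw [mem_sphere_zero_iff_norm] at hw ⊢
      rw [h.norm_sub_map ha hb, hab] at hwm
      have h2 := norm_sub_le_norm_sub_add_norm_sub w m' (f y)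
      have h1 : ε g w = 1 := by rw [hE w (by linarith), hw]
      have h3 := norm_add_le (m' - w) (m' - f y)
      rw [norm_sub_rev m' w] at h3
      rw [← hE _ (by
        rw [show (2 : ℝ) • m' - w - f y = m' - w + (m' - f y) by module]; linarith), map_sub,
        map_smul, h1, hεm']
      norm_num
  rw [homExt_of_norm_eq_one f ha, homExt_of_norm_eq_one f hb, homExt_of_norm_eq_one f hy, key, hm']
  module

lemma homExt_add_of_unique_active (h : FacetCorrespondence f ε) {g : X →L[ℝ] ℝ}
    (hg : g ∈ facetFn X) {x y : X} (hx0 : x ≠ 0) (hgx : g x = ‖x‖) (hgy : g y = ‖y‖)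
    (huniq : ∀ g' ∈ facetFn X, g' x = ‖x‖ → g' = g) :
    homExt f (x + y) = homExt f x + homExt f y := by
  rcases eq_or_ne y 0 with rfl | hy0
  · simp [homExt_zero]
  have hx := norm_pos_iff.2 hx0
  have hy := norm_pos_iff.2 hy0
  set a := unitDir x with ha
  set b := unitDir y with hb
  have hga : g a = 1 := by simp [ha, unitDir, hgx, hx.ne']
  have hgb : g b = 1 := by simp [hb, unitDir, hgy, hy.ne']
  have ha1 : ‖a‖ = 1 := norm_unitDir hx0
  have hb1 : ‖b‖ = 1 := norm_unitDir hy0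
  have huniq' : ∀ g' ∈ facetFn X, g' a = 1 → g' = g := fun g' hg' h' => huniq g' hg' (by
    rw [← norm_smul_unitDir x, map_smul, ← ha, h', norm_smul, ha1, norm_norm, smul_eq_mul])
  set φ : ℝ → E := fun t => homExt f ((1 - t) • a + t • b) with hφ
  have hφc : Continuous φ := h.continuous_homExt.comp (by fun_prop)
  have hmid : ∀ t ∈ Ioo (0 : ℝ) 1, ∀ᶠ δ in 𝓝[>] (0 : ℝ),
      φ (t + δ) + φ (t - δ) = (2 : ℝ) • φ t := by
    rintro t ⟨ht0, ht1⟩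
    set c := (1 - t) • a + t • b with hc
    have hgc : g c = 1 := by rw [hc, map_add, map_smul, map_smul, hga, hgb]; simp
    have hc1 : ‖c‖ = 1 := by
      refine le_antisymm ?_ (hgc ▸ le_norm_of_mem_facetFn hg c)
      refine (norm_add_le _ _).trans ?_
      rw [norm_smul, norm_smul, ha1, hb1, Real.norm_of_nonneg ht0.le,
        Real.norm_of_nonneg (sub_pos.2 ht1).le]
      linarith
    have hcu : ∀ g' ∈ facetFn X, g' c = 1 → g' = g := by
      intro g' hg' h'
      refine huniq' g' hg' ?_
      have h1 := le_norm_of_mem_facetFn hg' a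
      have h2 := le_norm_of_mem_facetFn hg' b
      rw [ha1] at h1
      rw [hb1] at h2
      rw [hc, map_add, map_smul, map_smul, smul_eq_mul, smul_eq_mul] at h'
      nlinarith
    have hl : Tendsto (fun δ : ℝ => δ • (b - a)) (𝓝[>] 0) (𝓝 0) := by
      have : ContinuousAt (fun δ : ℝ => δ • (b - a)) 0 := by fun_prop
      simpa using this.tendsto.mono_left nhdsWithin_le_nhds
    filter_upwards [hl.eventually (h.eventually_homExt_add_sub hg hc1 hgc hcu)] with δ hδ
    have := hδ (by simp [hga, hgb])
    rw [hφ]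
    beta_reduce
    rw [← hc, ← this]
    congr 2 <;> rw [hc] <;> module
  have haff := eq_lineMap_of_locally_midpoint hφc.continuousOn hmid
    (t := ‖y‖ / (‖x‖ + ‖y‖)) ⟨by positivity, (div_le_one (by positivity)).2 (by linarith)⟩
  simp only [hφ, sub_zero, one_smul, zero_smul, add_zero, sub_self, zero_add] at haff
  have hs : 0 < ‖x‖ + ‖y‖ := by positivity
  have h1 : 1 - ‖y‖ / (‖x‖ + ‖y‖) = (‖x‖ + ‖y‖)⁻¹ * ‖x‖ := by field_simp; ring
  have h2 : ‖y‖ / (‖x‖ + ‖y‖) = (‖x‖ + ‖y‖)⁻¹ * ‖y‖ := by field_simp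
  rw [h1, h2, mul_smul, mul_smul, mul_smul, mul_smul, norm_smul_unitDir, norm_smul_unitDir,
    ← smul_add, homExt_smul f (inv_nonneg.2 hs.le), ← homExt_smul f (norm_nonneg x),
    ← homExt_smul f (norm_nonneg y), norm_smul_unitDir, norm_smul_unitDir, ← smul_add] at haff
  exact smul_right_injective E (inv_ne_zero hs.ne') haff

/-- The extension is additive on the cone over a facet. -/
lemma homExt_add_of_mem_cone (h : FacetCorrespondence f ε) {g : X →L[ℝ] ℝ}
    (hg : g ∈ facetFn X) {x y : X} (hgx : g x = ‖x‖) (hgy : g y = ‖y‖) :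
    homExt f (x + y) = homExt f x + homExt f y := by
  obtain ⟨x₀, hx₀, hgx₀, huniq⟩ := exists_unique_active hg
  have hcont := h.continuous_homExt
  have hsum : ∀ s : ℝ, 0 < s →
      homExt f (x + s • x₀ + y) = homExt f (x + s • x₀) + homExt f y := by
    intro s hs
    have hgs : g (x + s • x₀) = ‖x‖ + s := by simp [hgx, hgx₀]
    have hnorm : ‖x + s • x₀‖ = ‖x‖ + s := by
      refine le_antisymm ((norm_add_le _ _).trans ?_) (hgs ▸ le_norm_of_mem_facetFn hg _)
      rw [norm_smul, hx₀, Real.norm_of_nonneg hs.le, mul_one]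
    have hpos : 0 < ‖x + s • x₀‖ := by rw [hnorm]; positivity
    refine h.homExt_add_of_unique_active hg (norm_pos_iff.1 hpos) (hgs.trans hnorm.symm) hgy
      fun g' hg' h' => huniq g' hg' ?_
    rw [hnorm, map_add, map_smul, smul_eq_mul] at h'
    have h1 := le_norm_of_mem_facetFn hg' x
    have h2 := le_norm_of_mem_facetFn hg' x₀
    rw [hx₀] at h2
    nlinarith
  have hl : Tendsto (fun s : ℝ => homExt f (x + s • x₀ + y)) (𝓝[>] 0) (𝓝 (homExt f (x + y))) := by
    have : Continuous fun s : ℝ => homExt f (x + s • x₀ + y) := hcont.comp (by fun_prop)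
    simpa using (this.tendsto 0).mono_left nhdsWithin_le_nhds
  have hr : Tendsto (fun s : ℝ => homExt f (x + s • x₀ + y)) (𝓝[>] 0)
      (𝓝 (homExt f x + homExt f y)) := by
    have : Continuous fun s : ℝ => homExt f (x + s • x₀) + homExt f y :=
      (hcont.comp (by fun_prop)).add continuous_const
    have h0 := (this.tendsto 0).mono_left (nhdsWithin_le_nhds (s := Ioi 0))
    simp only [zero_smul, add_zero] at h0
    refine h0.congr' ?_
    filter_upwards [self_mem_nhdsWithin] with s hs
    exact (hsum s hs).symm
  exact tendsto_nhds_unique hl hr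

lemma eventually_apply_homExt_eq_of_vertex (h : FacetCorrespondence f ε) {y y' : X}
    (hy' : ‖y'‖ = 1) (hface : ∀ g ∈ facetFn X, g y = ‖y‖ → g y' = 1) :
    ∀ᶠ z in 𝓝 y, ∀ g ∈ facetFn X, g y' = 1 → ε g (homExt f z) = g z := by
  filter_upwards [eventually_active h.finite y] with z hz g hg hgy'
  obtain ⟨k, hk, hkz⟩ := exists_mem_facetFn_eq_norm h.finite z
  have hky' : k y' = ‖y'‖ := (hface k hk (hz k hk hkz)).trans hy'.symm
  have hl : Tendsto (fun s : ℝ => y' + s • z) (𝓝[>] 0) (𝓝 y') := by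
    have : ContinuousAt (fun s : ℝ => y' + s • z) 0 := by fun_prop
    simpa using this.tendsto.mono_left nhdsWithin_le_nhds
  obtain ⟨s, hs, hs0⟩ := ((hl.eventually (h.eventually_apply_homExt_eq hg hy' hgy')).and
    self_mem_nhdsWithin).exists
  have hs0 : 0 < s := hs0
  rw [h.homExt_add_of_mem_cone hk hky' (y := s • z)
    (by rw [map_smul, hkz, norm_smul, Real.norm_of_nonneg hs0.le, smul_eq_mul]),
    homExt_smul f hs0.le, homExt_of_norm_eq_one f hy', map_add, map_add,
    (h.eq_one_iff g hg y' hy').2 hgy', hgy', map_smul, map_smul, smul_eq_mul, smul_eq_mul] at hs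
  exact mul_left_cancel₀ hs0.ne' (add_left_cancel hs)

lemma homExt_neg (h : FacetCorrespondence f ε) (y : X) : homExt f (-y) = -homExt f y := by
  rcases eq_or_ne y 0 with rfl | hy
  · simp [homExt_zero]
  obtain ⟨y', hy', hface, hvert⟩ := exists_vertex h.finite hy
  have h1 := (h.eventually_apply_homExt_eq_of_vertex hy' hface).self_of_nhds
  have h2 := (h.neg_comp_neg.eventually_apply_homExt_eq_of_vertex hy' hface).self_of_nhds
  have : homExt f (-y) + homExt f y = 0 := by
    refine h.eq_zero_of_forall_active hy' hvert fun g hg hgy' => ?_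
    have h3 := h2 g hg hgy'
    rw [homExt_neg_comp_neg, map_neg] at h3
    rw [map_add, h1 g hg hgy']
    linarith
  exact eq_neg_of_add_eq_zero_left this

lemma homExt_smul (h : FacetCorrespondence f ε) (c : ℝ) (x : X) :
    homExt f (c • x) = c • homExt f x := by
  rcases le_total 0 c with hc | hc
  · exact _root_.homExt_smul f hc x
  · have := _root_.homExt_smul f (neg_nonneg.2 hc) x
    rwa [neg_smul, h.homExt_neg, neg_smul, neg_inj] at this

lemma eventually_homExt_add_sub_of_ne_zero (h : FacetCorrespondence f ε) {y : X} (hy : y ≠ 0) :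
    ∀ᶠ u in 𝓝 (0 : X), homExt f (y + u) + homExt f (y - u) = (2 : ℝ) • homExt f y := by
  obtain ⟨y', hy', hface, hvert⟩ := exists_vertex h.finite hy
  have hev := h.eventually_apply_homExt_eq_of_vertex hy' hface
  have hl1 : Tendsto (fun u : X => y + u) (𝓝 0) (𝓝 y) := by
    simpa using (continuous_const_add y).tendsto 0
  have hl2 : Tendsto (fun u : X => y - u) (𝓝 0) (𝓝 y) := by
    simpa using (continuous_sub_left y).tendsto 0
  filter_upwards [hl1.eventually hev, hl2.eventually hev] with u h1 h2
  refine sub_eq_zero.1 (h.eq_zero_of_forall_active hy' hvert fun g hg hgy' => ?_)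
  rw [map_sub, map_add, map_smul, h1 g hg hgy', h2 g hg hgy', hev.self_of_nhds g hg hgy', map_add,
    map_sub, smul_eq_mul]
  ring

lemma homExt_add (h : FacetCorrespondence f ε) (x y : X) :
    homExt f (x + y) = homExt f x + homExt f y := by
  rcases eq_or_ne x 0 with rfl | hx
  · simp [homExt_zero]
  by_cases hseg : ∃ t ∈ Icc (0 : ℝ) 1, (1 - t) • x + t • y = 0
  · obtain ⟨t, ht, hxy⟩ := hseg
    have ht0 : t ≠ 0 := by
      rintro rfl
      exact hx (by simpa using hxy)
    have hy : y = (-(t⁻¹ * (1 - t))) • x := by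
      have h1 : t • y = -((1 - t) • x) := eq_neg_of_add_eq_zero_right hxy
      rw [neg_smul, mul_smul, ← smul_neg, ← h1, smul_smul, inv_mul_cancel₀ ht0, one_smul]
    generalize -(t⁻¹ * (1 - t)) = c at hy
    rw [hy, show x + c • x = (1 + c) • x by module, h.homExt_smul, h.homExt_smul]
    module
  · push Not at hseg
    set φ : ℝ → E := fun t => homExt f ((1 - t) • x + t • y) with hφ
    have hφc : Continuous φ := h.continuous_homExt.comp (by fun_prop)
    have haff := eq_lineMap_of_locally_midpoint hφc.continuousOn (t := 2⁻¹) (fun t ht => ?_)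
      ⟨by norm_num, by norm_num⟩
    · simp only [hφ, sub_zero, one_smul, zero_smul, add_zero, sub_self, zero_add] at haff
      rw [show (1 - 2⁻¹ : ℝ) = 2⁻¹ by norm_num, ← smul_add, ← smul_add, h.homExt_smul] at haff
      exact smul_right_injective E (by norm_num : (2⁻¹ : ℝ) ≠ 0) haff
    · have hl : Tendsto (fun δ : ℝ => δ • (y - x)) (𝓝[>] 0) (𝓝 0) := by
        have : ContinuousAt (fun δ : ℝ => δ • (y - x)) 0 := by fun_prop
        simpa using this.tendsto.mono_left nhdsWithin_le_nhds
      filter_upwards [hl.eventually (h.eventually_homExt_add_sub_of_ne_zero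
        (hseg t (Ioo_subset_Icc_self ht)))] with δ hδ
      rw [hφ]
      beta_reduce
      rw [← hδ]
      congr 2 <;> module

/-- The homogeneous extension as a linear isometric equivalence. -/
def homExtEquiv (h : FacetCorrespondence f ε) : X ≃ₗᵢ[ℝ] E :=
  LinearIsometryEquiv.ofSurjective
    { toFun := homExt f
      map_add' := h.homExt_add
      map_smul' := h.homExt_smul
      norm_map' := h.norm_homExt } (fun z => by
    rcases eq_or_ne z 0 with rfl | hz
    · exact ⟨0, homExt_zero f⟩
    · obtain ⟨x, hx, hxz⟩ := h.exists_eq_map (norm_unitDir hz)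
      refine ⟨‖z‖ • x, ?_⟩
      change homExt f (‖z‖ • x) = z
      rw [h.homExt_smul, homExt_of_norm_eq_one f hx, hxz, norm_smul_unitDir])

end FacetCorrespondence

/-- **Main theorem.** If `X` is a finite-dimensional polyhedral space (its closed unit ball
is the convex hull of finitely many points), `E` is a finite-dimensional space and
`f : S_X → S_E` is a bijective isometry, then the positively homogeneous extension `F` of
`f` is linear, hence a surjective linear isometry from `X` onto `E` extending `f`. -/
theorem tingley_polyhedral {X E : Type*} [NormedAddCommGroup X] [NormedSpace ℝ X]
    [FiniteDimensional ℝ X] [NormedAddCommGroup E] [NormedSpace ℝ E] [FiniteDimensional ℝ E]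
    (hpoly : ∃ s : Finset X, closedBall (0 : X) 1 = convexHull ℝ (s : Set X))
    (f : X → E) (hbij : Set.BijOn f (sphere (0 : X) 1) (sphere (0 : E) 1))
    (hiso : ∀ x ∈ sphere (0 : X) 1, ∀ x' ∈ sphere (0 : X) 1, ‖f x - f x'‖ = ‖x - x'‖) :
    ∃ A : X ≃ₗᵢ[ℝ] E, ∀ x : X, homExt f x = A x := by
  rcases subsingleton_or_nontrivial X with hX | hX
  · have hE : Subsingleton E := by
      by_contra hE
      rw [not_subsingleton_iff_nontrivial] at hE
      obtain ⟨z, hz⟩ := exists_norm_eq E zero_le_one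
      obtain ⟨x, hx, -⟩ := hbij.surjOn (mem_sphere_zero_iff_norm.2 hz)
      rw [mem_sphere_zero_iff_norm, Subsingleton.elim x 0, norm_zero] at hx
      exact zero_ne_one hx
    exact ⟨⟨0, fun x => by simp [Subsingleton.elim x 0]⟩, fun x => Subsingleton.elim _ _⟩
  · have hE : Nontrivial E := by
      obtain ⟨x, hx⟩ := exists_norm_eq X zero_le_one
      have hfx := hbij.mapsTo (mem_sphere_zero_iff_norm.2 hx)
      exact ⟨f x, 0, ne_zero_of_norm_eq_one (mem_sphere_zero_iff_norm.1 hfx)⟩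
    obtain ⟨s, hs⟩ := hpoly
    obtain ⟨ε, h⟩ := exists_facetCorrespondence (finite_facetFn hs) hbij hiso
    exact ⟨h.homExtEquiv, fun _ => rfl⟩
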